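/- arXiv:1606.02611 — 2 statements merged into one kernel-verified Lean document; each statement's English description precedes it below -/
import Mathlib

section
/- Let W be the subgroup of linear automorphisms of ℝ⁴ generated by the four orthogonal reflections σ_α : x ↦ x − ⟪x,α⟫•α for α ∈ {e₀ − e₁, e₀ + e₁, e₂ − e₃, e₂ + e₃}. Then W maps Φ₁ to itself, hence permutes the A₃-subsets of Φ₁, and this action of W on the set of A₃-subsets of Φ₁ has exactly 6 orbits. -/
open scoped RealInnerProductSpace

/-- The Euclidean space `ℝ⁴`. -/
abbrev E4 : Type := EuclideanSpace ℝ (Fin 4)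

/-- The standard basis vector `eᵢ` of `ℝ⁴`. -/
noncomputable def ev (i : Fin 4) : E4 := EuclideanSpace.single i 1

/-- The 16-element set `Φ₁ = {s•eₐ + t•e_b : s,t ∈ {1,−1}, a ∈ {0,1}, b ∈ {2,3}}`. -/
def Phi1 : Set E4 :=
  {v | ∃ s t : ℝ, ∃ a b : Fin 4, (s = 1 ∨ s = -1) ∧ (t = 1 ∨ t = -1) ∧
    (a = 0 ∨ a = 1) ∧ (b = 2 ∨ b = 3) ∧ v = s • ev a + t • ev b}

/-- A three-element subset `S ⊆ Φ₁` is an `A₃`-subset if its elements can be ordered as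
`(u,v,w)` with `⟪u,v⟫ = −1`, `⟪v,w⟫ = −1` and `⟪u,w⟫ = 0`. -/
def IsA3Subset (S : Set E4) : Prop :=
  S ⊆ Phi1 ∧ S.ncard = 3 ∧
    ∃ u v w : E4, S = {u, v, w} ∧ ⟪u, v⟫ = -1 ∧ ⟪v, w⟫ = -1 ∧ ⟪u, w⟫ = 0

/-- The four roots `e₀ − e₁, e₀ + e₁, e₂ − e₃, e₂ + e₃`. -/
noncomputable def rootsA : Set E4 := {ev 0 - ev 1, ev 0 + ev 1, ev 2 - ev 3, ev 2 + ev 3}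

/-- The group `W` of linear automorphisms of `ℝ⁴` generated by the orthogonal reflections
`σ_α : x ↦ x − ⟪x,α⟫•α` for `α ∈ {e₀ − e₁, e₀ + e₁, e₂ − e₃, e₂ + e₃}`. -/
noncomputable def W4 : Subgroup (E4 ≃ₗ[ℝ] E4) :=
  Subgroup.closure {g : E4 ≃ₗ[ℝ] E4 | ∃ α ∈ rootsA, ∀ x : E4, g x = x - ⟪x, α⟫ • α}

theorem inner_ev (i j : Fin 4) : ⟪ev i, ev j⟫ = if i = j then 1 else 0 := by
  rw [ev, ev, EuclideanSpace.inner_single_left]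
  simp

theorem norm_ev (i : Fin 4) : ‖ev i‖ = 1 := by
  simp [ev]

theorem inner_self_of_mem_rootsA {α : E4} (hα : α ∈ rootsA) : ⟪α, α⟫ = 2 := by
  rcases hα with rfl | rfl | rfl | rfl <;>
    simp only [inner_add_left, inner_add_right, inner_sub_left, inner_sub_right, inner_ev] <;>
    simp <;> norm_num

theorem inner_self_of_mem_Phi1 {v : E4} (hv : v ∈ Phi1) : ⟪v, v⟫ = 2 := by
  obtain ⟨s, t, a, b, rfl | rfl, rfl | rfl, rfl | rfl, rfl | rfl, rfl⟩ := hv <;>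
    simp only [inner_add_left, inner_add_right, inner_smul_left, inner_smul_right, inner_ev] <;>
    simp <;> norm_num

theorem exists_reflection_mem_W4 {α : E4} (hα : α ∈ rootsA) :
    ∃ g ∈ W4, ∀ x : E4, g x = x - ⟪x, α⟫ • α := by
  have h : (innerₛₗ ℝ α : E4 →ₗ[ℝ] ℝ) α = 2 := inner_self_of_mem_rootsA hα
  have hg : ∀ x : E4, Module.reflection h x = x - ⟪x, α⟫ • α := fun x => by
    rw [Module.reflection_apply, real_inner_comm]; rfl
  exact ⟨Module.reflection h, Subgroup.subset_closure ⟨α, hα, hg⟩, hg⟩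

/-- `W` acts by isometries. -/
theorem inner_map_map_of_mem_W4 {g : E4 ≃ₗ[ℝ] E4} (hg : g ∈ W4) :
    ∀ x y : E4, ⟪g x, g y⟫ = ⟪x, y⟫ := by
  induction hg using Subgroup.closure_induction with
  | mem g hg =>
    obtain ⟨α, hα, h⟩ := hg
    intro x y
    rw [h, h]
    simp only [inner_sub_left, inner_sub_right, real_inner_smul_left, real_inner_smul_right,
      inner_self_of_mem_rootsA hα, real_inner_comm y α]
    ring
  | one => simp
  | mul g h _ _ ihg ihh => intro x y; simp [LinearEquiv.mul_apply, ihg, ihh]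
  | inv g _ ih =>
    intro x y
    rw [← ih]
    simp

theorem mapsTo_Phi1_of_reflection {g : E4 ≃ₗ[ℝ] E4} {α : E4} (hα : α ∈ rootsA)
    (hg : ∀ x : E4, g x = x - ⟪x, α⟫ • α) {v : E4} (hv : v ∈ Phi1) : g v ∈ Phi1 := by
  obtain ⟨s, t, a, b, hs, ht, ha, hb, rfl⟩ := hv
  have h₁ : ∃ s' : ℝ, ∃ a', (s' = 1 ∨ s' = -1) ∧ (a' = 0 ∨ a' = 1) ∧ g (ev a) = s' • ev a' := by
    rcases hα with rfl | rfl | rfl | rfl <;> rcases ha with rfl | rfl <;>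
      simp [hg, inner_add_right, inner_sub_right, inner_ev, norm_ev]
  have h₂ : ∃ t' : ℝ, ∃ b', (t' = 1 ∨ t' = -1) ∧ (b' = 2 ∨ b' = 3) ∧ g (ev b) = t' • ev b' := by
    rcases hα with rfl | rfl | rfl | rfl <;> rcases hb with rfl | rfl <;>
      simp [hg, inner_add_right, inner_sub_right, inner_ev, norm_ev]
  obtain ⟨s', a', hs', ha', h₁⟩ := h₁
  obtain ⟨t', b', ht', hb', h₂⟩ := h₂
  refine ⟨s * s', t * t', a', b', ?_, ?_, ha', hb', ?_⟩
  · rcases hs with rfl | rfl <;> rcases hs' with rfl | rfl <;> simp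
  · rcases ht with rfl | rfl <;> rcases ht' with rfl | rfl <;> simp
  · rw [map_add, map_smul, map_smul, h₁, h₂, smul_smul, smul_smul]

theorem image_mul (g h : E4 ≃ₗ[ℝ] E4) (S : Set E4) : (g * h : E4 ≃ₗ[ℝ] E4) '' S = g '' (h '' S) :=
  Set.image_comp g h S

theorem image_Phi1_of_mem_W4 {g : E4 ≃ₗ[ℝ] E4} (hg : g ∈ W4) : g '' Phi1 = Phi1 := by
  induction hg using Subgroup.closure_induction with
  | mem g hg =>
    obtain ⟨α, hα, h⟩ := hg
    have hinv : ∀ x, g (g x) = x := fun x => by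
      rw [h (g x), h x, inner_sub_left, real_inner_smul_left, inner_self_of_mem_rootsA hα]
      module
    refine Set.Subset.antisymm ?_ fun v hv => ⟨g v, mapsTo_Phi1_of_reflection hα h hv, hinv v⟩
    rintro _ ⟨v, hv, rfl⟩
    exact mapsTo_Phi1_of_reflection hα h hv
  | one => simp
  | mul g h _ _ ihg ihh =>
    rw [image_mul, ihh, ihg]
  | inv g _ ih =>
    conv_lhs => rw [← ih]
    rw [← image_mul, inv_mul_cancel]
    simp

theorem map_mem_Phi1 {g : E4 ≃ₗ[ℝ] E4} (hg : g ∈ W4) {v : E4} (hv : v ∈ Phi1) : g v ∈ Phi1 :=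
  image_Phi1_of_mem_W4 hg ▸ Set.mem_image_of_mem g hv

theorem IsA3Subset.image {g : E4 ≃ₗ[ℝ] E4} (hg : g ∈ W4) {S : Set E4} (hS : IsA3Subset S) :
    IsA3Subset (g '' S) := by
  obtain ⟨hS, hc, u, v, w, rfl, huv, hvw, huw⟩ := hS
  refine ⟨?_, by rw [Set.ncard_image_of_injective _ g.injective, hc], g u, g v, g w, ?_, ?_⟩
  · rw [← image_Phi1_of_mem_W4 hg]
    exact Set.image_mono hS
  · simp [Set.image_insert_eq]
  · simp [inner_map_map_of_mem_W4 hg, *]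

/-- The generating reflections have parallel or orthogonal roots, so `W` is commutative. -/
theorem commute_of_mem_W4 {g h : E4 ≃ₗ[ℝ] E4} (hg : g ∈ W4) (hh : h ∈ W4) : g * h = h * g := by
  have hcomm : ∀ α ∈ rootsA, ∀ β ∈ rootsA, α = β ∨ ⟪α, β⟫ = 0 := by
    rintro _ (rfl | rfl | rfl | rfl) _ (rfl | rfl | rfl | rfl) <;>
      simp [inner_add_left, inner_add_right, inner_sub_left, inner_sub_right, inner_ev,
        norm_ev]
  have : IsMulCommutative W4 := Subgroup.isMulCommutative_closure (k := {g : E4 ≃ₗ[ℝ] E4 | ∃ α ∈ rootsA,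
      ∀ x : E4, g x = x - ⟪x, α⟫ • α}) <| by
    rintro g ⟨α, hα, hg⟩ h ⟨β, hβ, hh⟩
    ext1 x
    rw [LinearEquiv.mul_apply, LinearEquiv.mul_apply, hg, hh, hh, hg]
    rcases hcomm α hα β hβ with rfl | h0
    · rfl
    · simp only [inner_sub_left, real_inner_smul_left, real_inner_comm α β, h0]
      module
  exact congrArg Subtype.val (mul_comm' (⟨g, hg⟩ : W4) ⟨h, hh⟩)

/-- A base point of `Φ₁`. -/
noncomputable def basePoint : E4 := ev 0 + ev 2

theorem basePoint_mem : basePoint ∈ Phi1 :=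
  ⟨1, 1, 0, 2, by simp, by simp, by simp, by simp, by simp [basePoint]⟩

theorem exists_mem_W4_map_basePoint {v : E4} (hv : v ∈ Phi1) : ∃ g ∈ W4, g basePoint = v := by
  obtain ⟨s, t, a, b, hs, ht, ha, hb, rfl⟩ := hv
  obtain ⟨r₁, h₁, e₁⟩ := exists_reflection_mem_W4 (α := ev 0 - ev 1) (by simp [rootsA])
  obtain ⟨r₂, h₂, e₂⟩ := exists_reflection_mem_W4 (α := ev 0 + ev 1) (by simp [rootsA])
  obtain ⟨r₃, h₃, e₃⟩ := exists_reflection_mem_W4 (α := ev 2 - ev 3) (by simp [rootsA])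
  obtain ⟨r₄, h₄, e₄⟩ := exists_reflection_mem_W4 (α := ev 2 + ev 3) (by simp [rootsA])
  have hl : ∃ g ∈ W4, g (ev 0) = s • ev a ∧ g (ev 2) = ev 2 := by
    rcases hs with rfl | rfl <;> rcases ha with rfl | rfl
    · exact ⟨1, one_mem _, by simp⟩
    · exact ⟨r₁, h₁, by simp [e₁, inner_sub_right, inner_ev, norm_ev]⟩
    · exact ⟨r₁ * r₂, mul_mem h₁ h₂, by
        simp [e₁, e₂, inner_sub_right, inner_add_right, inner_ev, norm_ev]; abel⟩
    · exact ⟨r₂, h₂, by simp [e₂, inner_add_right, inner_ev, norm_ev]⟩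
  have hr : ∃ g ∈ W4, g (ev 2) = t • ev b ∧ g (ev 0) = ev 0 ∧ g (ev 1) = ev 1 := by
    rcases ht with rfl | rfl <;> rcases hb with rfl | rfl
    · exact ⟨1, one_mem _, by simp⟩
    · exact ⟨r₃, h₃, by simp [e₃, inner_sub_right, inner_ev, norm_ev]⟩
    · exact ⟨r₃ * r₄, mul_mem h₃ h₄, by
        simp [e₃, e₄, inner_sub_right, inner_add_right, inner_ev, norm_ev]; abel⟩
    · exact ⟨r₄, h₄, by simp [e₄, inner_add_right, inner_ev, norm_ev]⟩
  obtain ⟨g, hg, hg0, hg2⟩ := hl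
  obtain ⟨h, hh, hh2, hh0, hh1⟩ := hr
  refine ⟨h * g, mul_mem hh hg, ?_⟩
  have : h (ev a) = ev a := by rcases ha with rfl | rfl <;> assumption
  simp [basePoint, hg0, hg2, hh2, this]

/-- The stabilizer of the base point fixes `Φ₁` pointwise. -/
theorem eq_of_map_basePoint {g : E4 ≃ₗ[ℝ] E4} (hg : g ∈ W4) (h0 : g basePoint = basePoint)
    {v : E4} (hv : v ∈ Phi1) : g v = v := by
  obtain ⟨h, hh, rfl⟩ := exists_mem_W4_map_basePoint hv
  rw [← LinearEquiv.mul_apply, commute_of_mem_W4 hg hh, LinearEquiv.mul_apply, h0]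

open Classical in
/-- The elements of `Φ₁` having inner product `-1` with the base point. -/
noncomputable def baseNeighbors : Finset E4 :=
  {-ev 0 + ev 3, -ev 0 - ev 3, ev 1 - ev 2, -ev 1 - ev 2}

theorem mem_baseNeighbors {x : E4} :
    x ∈ baseNeighbors ↔ x ∈ Phi1 ∧ ⟪x, basePoint⟫ = -1 := by
  constructor
  · intro hx
    simp only [baseNeighbors, Finset.mem_insert, Finset.mem_singleton] at hx
    rcases hx with rfl | rfl | rfl | rfl
    · exact ⟨⟨-1, 1, 0, 3, by simp⟩, by
        simp [basePoint, inner_add_left, inner_add_right, inner_neg_left, inner_ev, norm_ev]⟩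
    · exact ⟨⟨-1, -1, 0, 3, by simp [sub_eq_add_neg]⟩, by
        simp [basePoint, inner_sub_left, inner_add_right, inner_neg_left, inner_ev, norm_ev]⟩
    · exact ⟨⟨1, -1, 1, 2, by simp [sub_eq_add_neg]⟩, by
        simp [basePoint, inner_sub_left, inner_add_right, inner_ev, norm_ev]⟩
    · exact ⟨⟨-1, -1, 1, 2, by simp [sub_eq_add_neg]⟩, by
        simp [basePoint, inner_sub_left, inner_add_right, inner_neg_left, inner_ev, norm_ev]⟩
  · rintro ⟨⟨s, t, a, b, rfl | rfl, rfl | rfl, rfl | rfl, rfl | rfl, rfl⟩, h⟩ <;>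
      simp only [basePoint, inner_add_left, inner_add_right, real_inner_smul_left, inner_ev] at h <;>
      simp at h <;>
      first
      | (exfalso; norm_num at h; done)
      | simp [baseNeighbors, sub_eq_add_neg]

theorem inner_baseNeighbors {x y : E4} (hx : x ∈ baseNeighbors) (hy : y ∈ baseNeighbors)
    (hxy : x ≠ y) : ⟪x, y⟫ = 0 := by
  simp only [baseNeighbors, Finset.mem_insert, Finset.mem_singleton] at hx hy
  rcases hx with rfl | rfl | rfl | rfl <;> rcases hy with rfl | rfl | rfl | rfl <;>
    first
    | exact absurd rfl hxy
    | simp [inner_add_left, inner_add_right, inner_sub_left, inner_sub_right, inner_neg_left,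
        inner_neg_right, inner_ev, norm_ev]

theorem card_baseNeighbors : baseNeighbors.card = 4 := by
  have h : ∀ {x y : E4}, x 1 ≠ y 1 ∨ x 2 ≠ y 2 ∨ x 3 ≠ y 3 → x ≠ y := by
    rintro x _ h rfl
    simp at h
  rw [baseNeighbors, Finset.card_insert_of_notMem, Finset.card_insert_of_notMem,
    Finset.card_insert_of_notMem, Finset.card_singleton]
  all_goals
    simp only [Finset.mem_insert, Finset.mem_singleton, not_or]
    repeat' apply And.intro
    all_goals
      apply h
      simp [ev]
      try norm_num

theorem basePoint_notMem_baseNeighbors : basePoint ∉ baseNeighbors := fun h => by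
  have h₁ := (mem_baseNeighbors.1 h).2
  rw [inner_self_of_mem_Phi1 basePoint_mem] at h₁
  norm_num at h₁

theorem isA3Subset_insert_basePoint {P : Finset E4} (hP : P ∈ baseNeighbors.powersetCard 2) :
    IsA3Subset (insert basePoint (P : Set E4)) := by
  obtain ⟨hP, hc⟩ := Finset.mem_powersetCard.1 hP
  refine ⟨?_, ?_, ?_⟩
  · rintro x (rfl | hx)
    exacts [basePoint_mem, (mem_baseNeighbors.1 (hP hx)).1]
  · rw [Set.ncard_insert_of_notMem (fun h => basePoint_notMem_baseNeighbors (hP h)),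
      Set.ncard_coe_finset, hc]
  · classical
    obtain ⟨u, w, huw, rfl⟩ := Finset.card_eq_two.1 hc
    have hu : u ∈ baseNeighbors := hP (by simp)
    have hw : w ∈ baseNeighbors := hP (by simp)
    refine ⟨u, basePoint, w, ?_, (mem_baseNeighbors.1 hu).2, ?_, inner_baseNeighbors hu hw huw⟩
    · rw [Finset.coe_pair, Set.insert_comm]
    · rw [real_inner_comm, (mem_baseNeighbors.1 hw).2]

/-- Every `A₃`-subset is `W`-conjugate to one whose middle element is the base point. -/
theorem IsA3Subset.exists_image_insert_basePoint {S : Set E4} (hS : IsA3Subset S) :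
    ∃ P ∈ baseNeighbors.powersetCard 2, ∃ g ∈ W4, g '' insert basePoint (P : Set E4) = S := by
  classical
  obtain ⟨hS, -, u, v, w, rfl, huv, hvw, huw⟩ := hS
  have hu : u ∈ Phi1 := hS (by simp)
  have hw : w ∈ Phi1 := hS (by simp)
  obtain ⟨g, hg, rfl⟩ := exists_mem_W4_map_basePoint (hS (by simp : v ∈ _))
  have key : ∀ x ∈ Phi1, ⟪x, g basePoint⟫ = -1 → ∃ y ∈ baseNeighbors, g y = x := by
    intro x hx h
    have hgx : g (g⁻¹ x) = x := by simp
    refine ⟨g⁻¹ x, mem_baseNeighbors.2 ⟨map_mem_Phi1 (inv_mem hg) hx, ?_⟩, hgx⟩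
    rw [← inner_map_map_of_mem_W4 hg, hgx, h]
  obtain ⟨x, hx, rfl⟩ := key u hu huv
  obtain ⟨y, hy, rfl⟩ := key w hw (by rw [real_inner_comm, hvw])
  refine ⟨{x, y}, Finset.mem_powersetCard.2 ⟨?_, Finset.card_pair ?_⟩, g, hg, ?_⟩
  · simp [Finset.insert_subset_iff, hx, hy]
  · rintro rfl
    rw [inner_self_of_mem_Phi1 hu] at huw
    norm_num at huw
  · rw [Finset.coe_pair, Set.image_insert_eq, Set.image_pair, Set.insert_comm]

/-- The middle element of an `A₃`-subset is determined by the subset. -/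
theorem map_basePoint_of_image_eq {P Q : Finset E4} (hP : P ∈ baseNeighbors.powersetCard 2)
    (hQ : Q ∈ baseNeighbors.powersetCard 2) {g : E4 ≃ₗ[ℝ] E4} (hg : g ∈ W4)
    (h : g '' insert basePoint (P : Set E4) = insert basePoint (Q : Set E4)) :
    g basePoint = basePoint := by
  rw [Finset.mem_powersetCard] at hP hQ
  have hmem : g basePoint ∈ insert basePoint (Q : Set E4) := h ▸ ⟨_, Set.mem_insert _ _, rfl⟩
  refine hmem.resolve_right fun hgQ => ?_
  obtain ⟨z, hz, hne⟩ := Finset.exists_mem_ne (by rw [hQ.2]; norm_num) (g basePoint)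
  obtain ⟨y, hy, rfl⟩ : z ∈ g '' insert basePoint (P : Set E4) := h ▸ Set.mem_insert_of_mem _ hz
  have h₀ := inner_baseNeighbors (hQ.1 hz) (hQ.1 hgQ) hne
  rcases hy with rfl | hy
  · exact hne rfl
  · rw [inner_map_map_of_mem_W4 hg, (mem_baseNeighbors.1 (hP.1 hy)).2] at h₀
    norm_num at h₀

theorem eq_of_image_insert_basePoint_eq {P Q : Finset E4}
    (hP : P ∈ baseNeighbors.powersetCard 2) (hQ : Q ∈ baseNeighbors.powersetCard 2)
    {g : E4 ≃ₗ[ℝ] E4} (hg : g ∈ W4)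
    (h : g '' insert basePoint (P : Set E4) = insert basePoint (Q : Set E4)) : P = Q := by
  have hfix := map_basePoint_of_image_eq hP hQ hg h
  have himg : g '' insert basePoint (P : Set E4) = insert basePoint (P : Set E4) := by
    rw [Set.image_congr fun x hx =>
      eq_of_map_basePoint hg hfix ((isA3Subset_insert_basePoint hP).1 hx), Set.image_id']
  rw [himg] at h
  have hn : ∀ R ∈ baseNeighbors.powersetCard 2, basePoint ∉ (R : Set E4) := fun R hR hb =>
    basePoint_notMem_baseNeighbors ((Finset.mem_powersetCard.1 hR).1 hb)
  rw [← Finset.coe_inj, ← Set.insert_sdiff_self_of_notMem (hn P hP), h,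
    Set.insert_sdiff_self_of_notMem (hn Q hQ)]

theorem orbit_image_eq {g : E4 ≃ₗ[ℝ] E4} (hg : g ∈ W4) (S : Set E4) :
    {T | ∃ h ∈ W4, h '' (g '' S) = T} = {T | ∃ h ∈ W4, h '' S = T} := by
  ext T
  constructor
  · rintro ⟨h, hh, rfl⟩
    exact ⟨h * g, mul_mem hh hg, image_mul h g S⟩
  · rintro ⟨h, hh, rfl⟩
    refine ⟨h * g⁻¹, mul_mem hh (inv_mem hg), ?_⟩
    rw [← image_mul, inv_mul_cancel_right]

/-- `W` maps `Φ₁` to itself, hence permutes the `A₃`-subsets of `Φ₁`, and its action on the set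
of `A₃`-subsets of `Φ₁` has exactly 6 orbits. -/
theorem weyl_orbits_on_A3_subsets :
    (∀ g ∈ W4, g '' Phi1 = Phi1) ∧
    (∀ g ∈ W4, ∀ S : Set E4, IsA3Subset S → IsA3Subset (g '' S)) ∧
    Set.ncard {O : Set (Set E4) |
      ∃ S : Set E4, IsA3Subset S ∧ O = {T | ∃ g ∈ W4, g '' S = T}} = 6 := by
  refine ⟨fun g hg => image_Phi1_of_mem_W4 hg, fun g hg S hS => hS.image hg, ?_⟩
  let orb : Finset E4 → Set (Set E4) := fun P =>
    {T | ∃ g ∈ W4, g '' insert basePoint (P : Set E4) = T}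
  have himg : {O : Set (Set E4) | ∃ S : Set E4, IsA3Subset S ∧ O = {T | ∃ g ∈ W4, g '' S = T}} =
      orb '' (baseNeighbors.powersetCard 2 : Finset (Finset E4)) := by
    ext O
    constructor
    · rintro ⟨S, hS, rfl⟩
      obtain ⟨P, hP, g, hg, rfl⟩ := hS.exists_image_insert_basePoint
      exact ⟨P, hP, (orbit_image_eq hg _).symm⟩
    · rintro ⟨P, hP, rfl⟩
      exact ⟨_, isA3Subset_insert_basePoint hP, rfl⟩
  have hinj : Set.InjOn orb (baseNeighbors.powersetCard 2 : Finset (Finset E4)) := by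
    intro P hP Q hQ h
    have hmem : insert basePoint (Q : Set E4) ∈ orb P := h ▸ ⟨1, one_mem _, by simp⟩
    obtain ⟨g, hg, hPQ⟩ := hmem
    exact eq_of_image_insert_basePoint_eq hP hQ hg hPQ
  rw [himg, hinj.ncard_image, Set.ncard_coe_finset, Finset.card_powersetCard,
    card_baseNeighbors]
  rfl
end

section
/- For every hypermatrix v ∈ V the matrix A(v) is symmetric, and for every g = (g₁,g₂,g₃,g₄) ∈ G one has A(g·v) = (g₁ ⊗ g₂) * A(v) * (g₁ ⊗ g₂)ᵀ, where g₁ ⊗ g₂ denotes the Kronecker product of the matrices g₁ and g₂ (indexed by Fin 2 × Fin 2). In particular, A(g·v) and A(v) are congruent symmetric matrices, so the signature of the tensor classifier A(v) is a G-invariant of v. -/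
/-- The space of real 2×2×2×2 hypermatrices. -/
abbrev V : Type := Fin 2 → Fin 2 → Fin 2 → Fin 2 → ℝ

/-- The group `SL₂(ℝ)⁴`. -/
abbrev G : Type :=
  Matrix.SpecialLinearGroup (Fin 2) ℝ × Matrix.SpecialLinearGroup (Fin 2) ℝ ×
    Matrix.SpecialLinearGroup (Fin 2) ℝ × Matrix.SpecialLinearGroup (Fin 2) ℝ

/-- The natural linear action of `G = SL₂(ℝ)⁴` on `V`. -/
noncomputable def actG (g : G) (T : V) : V := fun i₁ i₂ i₃ i₄ =>
  ∑ j₁ : Fin 2, ∑ j₂ : Fin 2, ∑ j₃ : Fin 2, ∑ j₄ : Fin 2,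
    (g.1 : Matrix (Fin 2) (Fin 2) ℝ) i₁ j₁ * (g.2.1 : Matrix (Fin 2) (Fin 2) ℝ) i₂ j₂ *
      (g.2.2.1 : Matrix (Fin 2) (Fin 2) ℝ) i₃ j₃ * (g.2.2.2 : Matrix (Fin 2) (Fin 2) ℝ) i₄ j₄ *
      T j₁ j₂ j₃ j₄

/-- The invariant antisymmetric tensor `ε = ![![0,1],![−1,0]]`. -/
def eps : Matrix (Fin 2) (Fin 2) ℝ := !![0, 1; -1, 0]

/-- The tensor classifier `A(v) = T₍₁,₂₎(v)`:
`A(v)((α₁,α₂),(β₁,β₂)) = Σ ε(a,c) ε(b,d) v(α₁,α₂,a,b) v(β₁,β₂,c,d)`. -/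
noncomputable def classifier (v : V) : Matrix (Fin 2 × Fin 2) (Fin 2 × Fin 2) ℝ :=
  fun p q => ∑ a : Fin 2, ∑ b : Fin 2, ∑ c : Fin 2, ∑ d : Fin 2,
    eps a c * eps b d * v p.1 p.2 a b * v q.1 q.2 c d

open scoped Matrix Kronecker

/-- The flattening of a hypermatrix along the first two and the last two indices. -/
def flatten (v : V) : Matrix (Fin 2 × Fin 2) (Fin 2 × Fin 2) ℝ :=
  fun p q => v p.1 p.2 q.1 q.2

theorem transpose_eps : epsᵀ = -eps := by
  ext i j
  fin_cases i <;> fin_cases j <;> simp [eps]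

theorem transpose_mul_eps_mul (M : Matrix (Fin 2) (Fin 2) ℝ) :
    Mᵀ * eps * M = M.det • eps := by
  ext i j
  fin_cases i <;> fin_cases j <;>
    simp [eps, Matrix.mul_apply, Fin.sum_univ_two, Matrix.det_fin_two] <;> ring

theorem classifier_eq_flatten (v : V) :
    classifier v = flatten v * (eps ⊗ₖ eps) * (flatten v)ᵀ := by
  ext p q
  simp only [classifier, flatten, Matrix.mul_apply, Matrix.transpose_apply,
    Matrix.kroneckerMap_apply, Fintype.sum_prod_type, Fin.sum_univ_two]
  ring

theorem flatten_actG (g : G) (v : V) :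
    flatten (actG g v) =
      ((g.1 : Matrix (Fin 2) (Fin 2) ℝ) ⊗ₖ (g.2.1 : Matrix (Fin 2) (Fin 2) ℝ)) * flatten v *
        ((g.2.2.1 : Matrix (Fin 2) (Fin 2) ℝ) ⊗ₖ (g.2.2.2 : Matrix (Fin 2) (Fin 2) ℝ))ᵀ := by
  ext p q
  simp only [actG, flatten, Matrix.mul_apply, Matrix.transpose_apply,
    Matrix.kroneckerMap_apply, Fintype.sum_prod_type, Fin.sum_univ_two]
  ring

theorem transpose_kronecker_mul_eps_mul (h k : Matrix.SpecialLinearGroup (Fin 2) ℝ) :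
    ((h : Matrix (Fin 2) (Fin 2) ℝ) ⊗ₖ (k : Matrix (Fin 2) (Fin 2) ℝ))ᵀ * (eps ⊗ₖ eps) *
      ((h : Matrix (Fin 2) (Fin 2) ℝ) ⊗ₖ (k : Matrix (Fin 2) (Fin 2) ℝ)) = eps ⊗ₖ eps := by
  rw [← Matrix.kroneckerMap_transpose, ← Matrix.mul_kronecker_mul, ← Matrix.mul_kronecker_mul,
    transpose_mul_eps_mul, transpose_mul_eps_mul, h.det_coe, k.det_coe, one_smul]

/-- For every `v ∈ V` the matrix `A(v)` is symmetric, and for every `g = (g₁,g₂,g₃,g₄) ∈ G` one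
has `A(g·v) = (g₁ ⊗ g₂) * A(v) * (g₁ ⊗ g₂)ᵀ`; in particular `A(g·v)` and `A(v)` are congruent,
so the signature of the tensor classifier `A(v)` is a `G`-invariant of `v`. -/
theorem classifier_symm_and_equivariant :
    ∀ v : V, (classifier v).IsSymm ∧
      ∀ g : G, classifier (actG g v) =
        ((g.1 : Matrix (Fin 2) (Fin 2) ℝ) ⊗ₖ (g.2.1 : Matrix (Fin 2) (Fin 2) ℝ)) * classifier v *
          ((g.1 : Matrix (Fin 2) (Fin 2) ℝ) ⊗ₖ (g.2.1 : Matrix (Fin 2) (Fin 2) ℝ))ᵀ := by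
  intro v
  refine ⟨?_, fun g => ?_⟩
  · have h : (eps ⊗ₖ eps)ᵀ = eps ⊗ₖ eps := by
      rw [← Matrix.kroneckerMap_transpose, transpose_eps]
      ext
      simp [Matrix.kroneckerMap_apply]
    rw [Matrix.IsSymm, classifier_eq_flatten, Matrix.transpose_mul, Matrix.transpose_mul,
      Matrix.transpose_transpose, h, Matrix.mul_assoc]
  · rw [classifier_eq_flatten, classifier_eq_flatten, flatten_actG]
    conv_rhs => rw [← transpose_kronecker_mul_eps_mul g.2.2.1 g.2.2.2]
    simp only [Matrix.transpose_mul, Matrix.transpose_transpose, Matrix.mul_assoc]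
end
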